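/- Let N ≥ 3 and let ω: ℝ^N → (0,∞) be radial, radially decreasing, with lim_{|x|→∞} |x|^{N-2} ω(x) = c₀ > 0 and ω bounded. Let g: ℝ^N → [0,∞) be integrable and satisfy g(x) ≤ C(1+|x|)^{-ϑ} with ϑ > N. Then lim_{|y|→∞} |y|^{N-2} ∫_{ℝ^N} g(x) ω(x - y) dx = c₀ ∫_{ℝ^N} g(x) dx. -/

import Mathlib

open MeasureTheory Filter

section RadialDecay

variable {E : Type*} [NormedAddCommGroup E]

/-- A function which decreases with the norm is Borel measurable. -/
lemma measurable_of_norm_antitone [NormedSpace ℝ E] [Nontrivial E] [MeasurableSpace E]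
    [BorelSpace E] {ω : E → ℝ} (hω : ∀ x z : E, ‖z‖ ≤ ‖x‖ → ω x ≤ ω z) : Measurable ω := by
  obtain ⟨e, he⟩ := exists_norm_eq E zero_le_one
  have hnorm (r : ℝ) : ‖max r 0 • e‖ = max r 0 := by
    rw [norm_smul, he, mul_one, Real.norm_of_nonneg (le_max_right _ _)]
  have hanti : Antitone fun r : ℝ => ω (max r 0 • e) := fun r s hrs => hω _ _ <| by
    rw [hnorm, hnorm]; exact max_le_max_right 0 hrs
  have hrepr : ω = (fun r : ℝ => ω (max r 0 • e)) ∘ norm := by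
    funext x
    have hx : ‖max ‖x‖ 0 • e‖ = ‖x‖ := by rw [hnorm, max_eq_left (norm_nonneg x)]
    exact le_antisymm (hω _ _ hx.le) (hω _ _ hx.ge)
  rw [hrepr]
  exact hanti.measurable.comp measurable_norm

/-- A bounded function for which `‖x‖ ^ p * ω x` converges at infinity is
`O((1 + ‖x‖) ^ (-p))`, uniformly on the whole space. -/
lemma exists_one_add_norm_rpow_mul_le [ProperSpace E] {ω : E → ℝ} {p c₀ M : ℝ} (hp : 0 ≤ p)
    (hωpos : ∀ x, 0 < ω x) (hbdd : ∀ x, ω x ≤ M)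
    (hlim : Tendsto (fun x : E => ‖x‖ ^ p * ω x) (cocompact E) (nhds c₀)) :
    ∃ K, ∀ x, (1 + ‖x‖) ^ p * ω x ≤ K := by
  have hev := hlim.eventually_lt_const (lt_add_one c₀)
  rw [← Metric.cobounded_eq_cocompact, ← comap_norm_atTop, eventually_comap,
    eventually_atTop] at hev
  obtain ⟨R, hR⟩ := hev
  have hM : 0 ≤ M := (hωpos 0).le.trans (hbdd 0)
  refine ⟨max (2 ^ p * (c₀ + 1)) ((1 + max R 1) ^ p * M),
    fun x => ?_⟩
  have hω := hωpos x
  rcases le_total (max R 1) ‖x‖ with hx | hx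
  · refine le_max_of_le_left ?_
    have h1 : 1 ≤ ‖x‖ := (le_max_right _ _).trans hx
    calc (1 + ‖x‖) ^ p * ω x ≤ (2 * ‖x‖) ^ p * ω x := by gcongr; linarith
      _ = 2 ^ p * (‖x‖ ^ p * ω x) := by
        rw [Real.mul_rpow zero_le_two (norm_nonneg x), mul_assoc]
      _ ≤ 2 ^ p * (c₀ + 1) := by
        gcongr
        exact (hR _ ((le_max_left _ _).trans hx) x rfl).le
  · refine le_max_of_le_right ?_
    have := hbdd x
    gcongr

/-- The limit of `‖y‖ ^ p * ω y` at infinity is not affected by a translation of `ω`. -/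
lemma tendsto_norm_rpow_mul_sub [ProperSpace E] {ω : E → ℝ} {p c₀ : ℝ}
    (hlim : Tendsto (fun x : E => ‖x‖ ^ p * ω x) (cocompact E) (nhds c₀)) (x : E) :
    Tendsto (fun y : E => ‖y‖ ^ p * ω (x - y)) (cocompact E) (nhds c₀) := by
  have hsub : Tendsto (fun y : E => x - y) (cocompact E) (cocompact E) :=
    (Homeomorph.subLeft x).isClosedEmbedding.tendsto_cocompact
  have hnorm : Tendsto (fun y : E => ‖x - y‖) (cocompact E) atTop :=
    (tendsto_norm_cocompact_atTop (E := E)).comp hsub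
  have hdiff : Tendsto (fun y : E => (‖y‖ - ‖x - y‖) / ‖x - y‖) (cocompact E) (nhds 0) := by
    refine squeeze_zero_norm (fun y => ?_) (hnorm.const_div_atTop ‖x‖)
    rw [norm_div, norm_norm]
    gcongr
    have := abs_norm_sub_norm_le y (y - x)
    rwa [norm_sub_rev y x, sub_sub_cancel] at this
  have hratio : Tendsto (fun y : E => ‖y‖ / ‖x - y‖) (cocompact E) (nhds 1) := by
    have h := hdiff.const_add 1
    rw [add_zero] at h
    refine h.congr' ?_
    filter_upwards [hnorm.eventually_gt_atTop 0] with y hy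
    field_simp
    ring
  have h := (hratio.rpow_const (p := p) (Or.inl one_ne_zero)).mul (hlim.comp hsub)
  rw [Real.one_rpow, one_mul] at h
  refine h.congr' ?_
  filter_upwards [hnorm.eventually_gt_atTop 0] with y hy
  have : ‖x - y‖ ^ p ≠ 0 := (Real.rpow_pos_of_pos hy p).ne'
  simp only [Function.comp_apply]
  rw [Real.div_rpow (norm_nonneg y) hy.le]
  field_simp

lemma isCountablyGenerated_cocompact [ProperSpace E] : (cocompact E).IsCountablyGenerated := by
  rw [← Metric.cobounded_eq_cocompact, ← comap_norm_atTop]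
  infer_instance

variable [MeasurableSpace E] [BorelSpace E] [ProperSpace E] {μ : Measure E}
  {ω g : E → ℝ} {p c₀ K : ℝ}

/-- The contribution of the points far from `y` carries the whole limit. -/
lemma tendsto_integral_indicator_far (hp : 0 ≤ p) (hω : Measurable ω) (hωpos : ∀ x, 0 < ω x)
    (hlim : Tendsto (fun x : E => ‖x‖ ^ p * ω x) (cocompact E) (nhds c₀))
    (hK : ∀ x, (1 + ‖x‖) ^ p * ω x ≤ K) (hg : ∀ x, 0 ≤ g x) (hgint : Integrable g μ) :
    Tendsto (fun y : E => ∫ x, {x | ‖y‖ / 2 ≤ ‖x - y‖}.indicator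
        (fun x => ‖y‖ ^ p * (g x * ω (x - y))) x ∂μ)
      (cocompact E) (nhds (c₀ * ∫ x, g x ∂μ)) := by
  have := isCountablyGenerated_cocompact (E := E)
  rw [← integral_const_mul]
  refine tendsto_integral_filter_of_dominated_convergence (fun x => 2 ^ p * K * g x) ?_ ?_
    (hgint.const_mul _) ?_
  · refine .of_forall fun y => AEStronglyMeasurable.indicator ?_
      (measurableSet_le measurable_const (by fun_prop))
    have hωy : Measurable fun x => ω (x - y) := hω.comp (measurable_sub_const y)
    exact (hgint.aestronglyMeasurable.mul hωy.aestronglyMeasurable).const_mul _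
  · refine .of_forall fun y => .of_forall fun x => ?_
    have hωx := hωpos (x - y)
    have hgx := hg x
    have hK0 : 0 ≤ K := le_trans (by positivity) (hK (x - y))
    rw [Real.norm_of_nonneg (Set.indicator_nonneg (fun _ _ => mul_nonneg (by positivity)
      (mul_nonneg (hg _) (hωpos _).le)) x)]
    refine Set.indicator_apply_le' (fun hx => ?_) fun _ => by positivity
    rw [Set.mem_ofPred_eq] at hx
    calc ‖y‖ ^ p * (g x * ω (x - y)) ≤ (2 * (1 + ‖x - y‖)) ^ p * (g x * ω (x - y)) := by
          gcongr; linarith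
      _ = 2 ^ p * ((1 + ‖x - y‖) ^ p * ω (x - y)) * g x := by
          rw [Real.mul_rpow zero_le_two (by positivity)]; ring
      _ ≤ 2 ^ p * K * g x := by gcongr; exact hK _
  · refine .of_forall fun x => ?_
    have h := (tendsto_norm_rpow_mul_sub hlim x).mul_const (g x)
    refine h.congr' ?_
    filter_upwards [(tendsto_norm_cocompact_atTop (E := E)).eventually_ge_atTop (2 * ‖x‖)]
      with y hy
    have hmem : x ∈ {x | ‖y‖ / 2 ≤ ‖x - y‖} := by
      have := norm_sub_norm_le y x
      rw [norm_sub_rev] at this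
      rw [Set.mem_ofPred_eq]
      linarith
    rw [Set.indicator_of_mem hmem]
    ring

/-- The contribution of the points close to `y` is negligible. -/
lemma tendsto_integral_indicator_near [NormedSpace ℝ E] [μ.IsAddHaarMeasure] {C ϑ : ℝ} (hp : 0 ≤ p) (hpϑ : p < ϑ)
    (hϑ : (Module.finrank ℝ E : ℝ) < ϑ) (hω : Measurable ω) (hωpos : ∀ x, 0 < ω x)
    (hK : ∀ x, (1 + ‖x‖) ^ p * ω x ≤ K) (hg : ∀ x, 0 ≤ g x) (hgint : Integrable g μ)
    (hgb : ∀ x, g x ≤ C * (1 + ‖x‖) ^ (-ϑ)) :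
    Tendsto (fun y : E => ∫ x, {x | ‖y‖ / 2 ≤ ‖x - y‖}ᶜ.indicator
        (fun x => ‖y‖ ^ p * (g x * ω (x - y))) x ∂μ)
      (cocompact E) (nhds 0) := by
  have := isCountablyGenerated_cocompact (E := E)
  have := FiniteDimensional.of_locallyCompactSpace ℝ (E := E)
  have hϑ0 : 0 < ϑ := hp.trans_lt hpϑ
  have hC : 0 ≤ C := by simpa using (hg 0).trans (hgb 0)
  have hK0 : 0 ≤ K := le_trans (mul_nonneg (by positivity) (hωpos 0).le) (hK 0)
  have hnonneg (y z : E) : 0 ≤ {x | ‖y‖ / 2 ≤ ‖x - y‖}ᶜ.indicator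
      (fun x => ‖y‖ ^ p * (g x * ω (x - y))) (z + y) :=
    Set.indicator_nonneg (fun _ _ => mul_nonneg (by positivity)
        (mul_nonneg (hg _) (hωpos _).le)) _
  have hbound (y z : E) : {x | ‖y‖ / 2 ≤ ‖x - y‖}ᶜ.indicator
      (fun x => ‖y‖ ^ p * (g x * ω (x - y))) (z + y) ≤
      C * 2 ^ ϑ * K * ((1 + ‖z‖) ^ (-p) * (1 + max ‖y‖ ‖z‖) ^ (-(ϑ - p))) := by
    refine Set.indicator_apply_le' (fun hz => ?_) fun _ => by positivity
    rw [Set.mem_compl_iff, Set.mem_ofPred_eq, not_le, add_sub_cancel_right] at hz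
    rw [add_sub_cancel_right, max_eq_left (by linarith [norm_nonneg y])]
    have hωz := hωpos z
    have hgz := hg (z + y)
    have hω' : ω z ≤ K * (1 + ‖z‖) ^ (-p) := by
      rw [Real.rpow_neg (by positivity), ← div_eq_mul_inv, le_div_iff₀ (by positivity), mul_comm]
      exact hK z
    have hg' : g (z + y) ≤ C * (2 ^ ϑ * (1 + ‖y‖) ^ (-ϑ)) := by
      refine (hgb _).trans ?_
      have hzy : (1 + ‖y‖) / 2 ≤ 1 + ‖z + y‖ := by
        have := norm_sub_norm_le y (-z)
        rw [norm_neg, sub_neg_eq_add, add_comm y z] at this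
        linarith
      gcongr
      calc (1 + ‖z + y‖) ^ (-ϑ) ≤ ((1 + ‖y‖) / 2) ^ (-ϑ) :=
            Real.rpow_le_rpow_of_nonpos (by positivity) hzy (by linarith)
        _ = 2 ^ ϑ * (1 + ‖y‖) ^ (-ϑ) := by
            rw [Real.div_rpow (by positivity) zero_le_two, Real.rpow_neg zero_le_two,
              div_inv_eq_mul, mul_comm]
    calc ‖y‖ ^ p * (g (z + y) * ω z)
        ≤ (1 + ‖y‖) ^ p * (C * (2 ^ ϑ * (1 + ‖y‖) ^ (-ϑ)) * (K * (1 + ‖z‖) ^ (-p))) := by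
          gcongr
          linarith
      _ = C * 2 ^ ϑ * K * ((1 + ‖z‖) ^ (-p) * ((1 + ‖y‖) ^ p * (1 + ‖y‖) ^ (-ϑ))) := by ring
      _ = _ := by
          rw [← Real.rpow_add (by positivity), neg_sub, sub_eq_add_neg p ϑ]
  have hshift (y : E) := integral_add_right_eq_self (μ := μ)
    ({x | ‖y‖ / 2 ≤ ‖x - y‖}ᶜ.indicator (fun x => ‖y‖ ^ p * (g x * ω (x - y)))) y
  simp_rw [← hshift]
  rw [← integral_zero E ℝ (μ := μ)]
  refine tendsto_integral_filter_of_dominated_convergence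
    (fun z => C * 2 ^ ϑ * K * (1 + ‖z‖) ^ (-ϑ)) ?_ ?_
    ((integrable_one_add_norm hϑ).const_mul _) ?_
  · refine .of_forall fun y => ?_
    have hωy : Measurable fun x => ω (x - y) := hω.comp (measurable_sub_const y)
    have hmeas := ((hgint.aestronglyMeasurable.mul hωy.aestronglyMeasurable).const_mul
      (‖y‖ ^ p)).indicator (measurableSet_le (measurable_const (a := ‖y‖ / 2))
        (by fun_prop : Measurable fun x : E => ‖x - y‖)).compl
    exact hmeas.comp_quasiMeasurePreserving
      (measurePreserving_add_right μ y).quasiMeasurePreserving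
  · refine .of_forall fun y => .of_forall fun z => ?_
    rw [Real.norm_of_nonneg (hnonneg y z)]
    refine (hbound y z).trans ?_
    gcongr
    calc (1 + ‖z‖) ^ (-p) * (1 + max ‖y‖ ‖z‖) ^ (-(ϑ - p))
        ≤ (1 + ‖z‖) ^ (-p) * (1 + ‖z‖) ^ (-(ϑ - p)) := by
          refine mul_le_mul_of_nonneg_left ?_ (by positivity)
          exact Real.rpow_le_rpow_of_nonpos (by positivity) (by gcongr; exact le_max_right _ _)
            (by linarith)
      _ = (1 + ‖z‖) ^ (-ϑ) := by
          rw [← Real.rpow_add (by positivity)]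
          congr 1
          ring
  · refine .of_forall fun z => squeeze_zero (fun y => hnonneg y z) (fun y => hbound y z) ?_
    have hmax : Tendsto (fun y : E => 1 + max ‖y‖ ‖z‖) (cocompact E) atTop :=
      tendsto_atTop_mono (fun y => by linarith [le_max_left ‖y‖ ‖z‖])
        (tendsto_norm_cocompact_atTop (E := E))
    simpa using (((tendsto_rpow_neg_atTop (sub_pos.2 hpϑ)).comp hmax).const_mul
      ((1 + ‖z‖) ^ (-p))).const_mul (C * 2 ^ ϑ * K)

end RadialDecay

/-- Lemma 3.3: if `ω` is radial, radially decreasing, bounded, with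
`|x|^{N-2} ω(x) → c₀ > 0`, and `g ≥ 0` is integrable with `g(x) ≤ C(1+|x|)^{-ϑ}`, `ϑ > N`,
then `|y|^{N-2} ∫ g(x) ω(x-y) dx → c₀ ∫ g`. -/
theorem stmt8 (N : ℕ) (hN : 3 ≤ N)
    (ω : EuclideanSpace ℝ (Fin N) → ℝ)
    (hωpos : ∀ x, 0 < ω x)
    (hωrad : ∀ x z : EuclideanSpace ℝ (Fin N), ‖z‖ ≤ ‖x‖ → ω x ≤ ω z)
    (c₀ : ℝ) (hc₀ : 0 < c₀)
    (hlim : Tendsto (fun x : EuclideanSpace ℝ (Fin N) => ‖x‖ ^ ((N : ℝ) - 2) * ω x)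
      (cocompact _) (nhds c₀))
    (M : ℝ) (hbdd : ∀ x, ω x ≤ M)
    (g : EuclideanSpace ℝ (Fin N) → ℝ) (hg : ∀ x, 0 ≤ g x) (hgint : Integrable g)
    (C ϑ : ℝ) (hϑ : (N : ℝ) < ϑ) (hgb : ∀ x, g x ≤ C * (1 + ‖x‖) ^ (-ϑ)) :
    Tendsto (fun y : EuclideanSpace ℝ (Fin N) =>
        ‖y‖ ^ ((N : ℝ) - 2) * ∫ x, g x * ω (x - y))
      (cocompact _) (nhds (c₀ * ∫ x, g x)) := by
  have hN' : (3 : ℝ) ≤ N := by exact_mod_cast hN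
  have hp : (0 : ℝ) ≤ (N : ℝ) - 2 := by linarith
  have : Nonempty (Fin N) := ⟨⟨0, by omega⟩⟩
  have hω : Measurable ω := measurable_of_norm_antitone hωrad
  obtain ⟨K, hK⟩ := exists_one_add_norm_rpow_mul_le hp hωpos hbdd hlim
  have hfar := tendsto_integral_indicator_far hp hω hωpos hlim hK hg hgint
  have hnear := tendsto_integral_indicator_near (μ := volume) hp (by linarith)
    (by rwa [finrank_euclideanSpace_fin]) hω hωpos hK hg hgint hgb
  have hsum := hfar.add hnear
  rw [add_zero] at hsum
  refine hsum.congr fun y => ?_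
  have hωy : Measurable fun x => ω (x - y) := hω.comp (measurable_sub_const y)
  have hint : Integrable fun x => ‖y‖ ^ ((N : ℝ) - 2) * (g x * ω (x - y)) :=
    (hgint.mul_bdd (c := M) hωy.aestronglyMeasurable (.of_forall fun x => by
      rw [Real.norm_of_nonneg (hωpos _).le]; exact hbdd _)).const_mul _
  have hs : MeasurableSet {x : EuclideanSpace ℝ (Fin N) | ‖y‖ / 2 ≤ ‖x - y‖} :=
    measurableSet_le measurable_const (by fun_prop)
  rw [integral_indicator hs, integral_indicator hs.compl, integral_add_compl hs hint,
    integral_const_mul]
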